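/- arXiv:2008.12953 — 3 statements merged into one kernel-verified Lean document; each statement's English description precedes it below -/
import Mathlib

section
/- The function φ₃ : ℝ^N → ℝ is twice differentiable and its Hessian at every w ∈ ℝ^N is the matrix ∇²φ₃(w) = 6 Φ (I_N ⊗ w), where I_N is the N×N identity matrix; that is, the second Fréchet derivative of φ₃ at w applied to (u, v) equals uᵀ (6 Φ (I_N ⊗ w)) v. -/
open Matrix Finset Filter Topology

noncomputable section

/-- Kronecker product `w ⊗ w` of a vector with itself, viewed as a vector in `ℝ^{N²}`. -/
def kron2 {N : ℕ} (w : Fin N → ℝ) : Fin N × Fin N → ℝ := fun p => w p.1 * w p.2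

/-- Kronecker product `w ⊗ w ⊗ w`, viewed as a vector in `ℝ^{N³}`. -/
def kron3 {N : ℕ} (w : Fin N → ℝ) : Fin N × Fin N × Fin N → ℝ :=
  fun p => w p.1 * w p.2.1 * w p.2.2

/-- Sample covariance matrix `Σ = (1/T) ∑ₜ rₜ rₜᵀ`. -/
def covar {N T : ℕ} (r : Fin T → Fin N → ℝ) : Matrix (Fin N) (Fin N) ℝ :=
  (1 / (T : ℝ)) • ∑ t, vecMulVec (r t) (r t)

/-- Co-skewness matrix `Φ = (1/T) ∑ₜ rₜ (rₜᵀ ⊗ rₜᵀ) ∈ ℝ^{N×N²}`. -/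
def coskew {N T : ℕ} (r : Fin T → Fin N → ℝ) : Matrix (Fin N) (Fin N × Fin N) ℝ :=
  (1 / (T : ℝ)) • ∑ t, vecMulVec (r t) (kron2 (r t))

/-- Co-kurtosis matrix `Ψ = (1/T) ∑ₜ rₜ (rₜᵀ ⊗ rₜᵀ ⊗ rₜᵀ) ∈ ℝ^{N×N³}`. -/
def cokurt {N T : ℕ} (r : Fin T → Fin N → ℝ) : Matrix (Fin N) (Fin N × Fin N × Fin N) ℝ :=
  (1 / (T : ℝ)) • ∑ t, vecMulVec (r t) (kron3 (r t))

/-- Third sample central moment `φ₃(w) = (1/T) ∑ₜ (wᵀ rₜ)³`. -/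
def phi3 {N T : ℕ} (r : Fin T → Fin N → ℝ) (w : Fin N → ℝ) : ℝ :=
  (1 / (T : ℝ)) * ∑ t, (w ⬝ᵥ r t) ^ 3

/-- Fourth sample central moment `φ₄(w) = (1/T) ∑ₜ (wᵀ rₜ)⁴`. -/
def phi4 {N T : ℕ} (r : Fin T → Fin N → ℝ) (w : Fin N → ℝ) : ℝ :=
  (1 / (T : ℝ)) * ∑ t, (w ⬝ᵥ r t) ^ 4

/-- The ℓ₁ norm `‖w‖₁ = ∑ᵢ |wᵢ|`. -/
def ell1 {N : ℕ} (w : Fin N → ℝ) : ℝ := ∑ i, |w i|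

/-- The largest-`k` norm `‖w‖_[k]`: the maximum of `∑_{i ∈ S} |wᵢ|` over subsets `S` of
cardinality `k` (for `k ≤ N` the set below is a nonempty finite set of reals, so its
supremum is this maximum). -/
def topk {N : ℕ} (k : ℕ) (w : Fin N → ℝ) : ℝ :=
  sSup {x : ℝ | ∃ S : Finset (Fin N), S.card = k ∧ x = ∑ i ∈ S, |w i|}

/-- `s` is a subgradient of the largest-`k` norm at `w`. -/
def IsSubgradTopk {N : ℕ} (k : ℕ) (w s : Fin N → ℝ) : Prop :=
  ∀ v : Fin N → ℝ, topk k w + s ⬝ᵥ (v - w) ≤ topk k v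

/-- Feasible set `C = {w : 1ᵀ w = 1, |wᵢ| ≤ α ∀i}`. -/
def Feas (N : ℕ) (α : ℝ) : Set (Fin N → ℝ) :=
  {w | ∑ i, w i = 1 ∧ ∀ i, |w i| ≤ α}

/-- Maximum absolute row sum `max_{1≤i≤N} ∑ⱼ |A_{ij}|` (as the supremum of a nonempty
finite set of reals when `N ≥ 1`). -/
def maxRowSum {N : ℕ} {J : Type} [Fintype J] (A : Matrix (Fin N) J ℝ) : ℝ :=
  sSup (Set.range fun i : Fin N => ∑ j, |A i j|)

/-- The DC constant `τ_dc = 6αλ₃ max-row-sum(Φ) + 12α²λ₄ max-row-sum(Ψ)`. -/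
def tauDC {N T : ℕ} (α l3 l4 : ℝ) (r : Fin T → Fin N → ℝ) : ℝ :=
  6 * α * l3 * maxRowSum (coskew r) + 12 * α ^ 2 * l4 * maxRowSum (cokurt r)

/-- Convex part `f_cvx(w) = -λ₁ μᵀw + λ₂ wᵀ Σ w`. -/
def fcvx {N T : ℕ} (l1 l2 : ℝ) (μ : Fin N → ℝ) (r : Fin T → Fin N → ℝ) (w : Fin N → ℝ) : ℝ :=
  -l1 * (μ ⬝ᵥ w) + l2 * (w ⬝ᵥ (covar r).mulVec w)

/-- Non-convex part `f_ncvx(w) = -λ₃ wᵀ Φ (w⊗w) + λ₄ wᵀ Ψ (w⊗w⊗w)`. -/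
def fncvx {N T : ℕ} (l3 l4 : ℝ) (r : Fin T → Fin N → ℝ) (w : Fin N → ℝ) : ℝ :=
  -l3 * (w ⬝ᵥ (coskew r).mulVec (kron2 w)) + l4 * (w ⬝ᵥ (cokurt r).mulVec (kron3 w))

/-- Gradient of the non-convex part: `∇f_ncvx(w) = -3λ₃ Φ(w⊗w) + 4λ₄ Ψ(w⊗w⊗w)`. -/
def gradfncvx {N T : ℕ} (l3 l4 : ℝ) (r : Fin T → Fin N → ℝ) (w : Fin N → ℝ) : Fin N → ℝ :=
  (-(3 * l3)) • (coskew r).mulVec (kron2 w) + (4 * l4) • (cokurt r).mulVec (kron3 w)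

/-- Gradient of the MVSK objective `∇f = ∇f_cvx + ∇f_ncvx`. -/
def gradf {N T : ℕ} (l1 l2 l3 l4 : ℝ) (μ : Fin N → ℝ) (r : Fin T → Fin N → ℝ)
    (w : Fin N → ℝ) : Fin N → ℝ :=
  ((-l1) • μ + (2 * l2) • (covar r).mulVec w) + gradfncvx l3 l4 r w

/-- The MVSK objective `f = f_cvx + f_ncvx`. -/
def ftot {N T : ℕ} (l1 l2 l3 l4 : ℝ) (μ : Fin N → ℝ) (r : Fin T → Fin N → ℝ)
    (w : Fin N → ℝ) : ℝ :=
  fcvx l1 l2 μ r w + fncvx l3 l4 r w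

/-- The penalized objective `f_p(w) = f(w) + ρ (‖w‖₁ - ‖w‖_[k])`. -/
def fpen {N T : ℕ} (l1 l2 l3 l4 ρ : ℝ) (k : ℕ) (μ : Fin N → ℝ) (r : Fin T → Fin N → ℝ)
    (w : Fin N → ℝ) : ℝ :=
  ftot l1 l2 l3 l4 μ r w + ρ * (ell1 w - topk k w)

/-- The Kronecker product `I_N ⊗ w ∈ ℝ^{N²×N}` of the identity matrix with a (column) vector. -/
def kronIdVec {N : ℕ} (w : Fin N → ℝ) : Matrix (Fin N × Fin N) (Fin N) ℝ :=
  Matrix.of fun p j => (1 : Matrix (Fin N) (Fin N) ℝ) p.1 j * w p.2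

/-- The Kronecker product `I_N ⊗ w ⊗ w ∈ ℝ^{N³×N}`. -/
def kronIdVec2 {N : ℕ} (w : Fin N → ℝ) : Matrix (Fin N × Fin N × Fin N) (Fin N) ℝ :=
  Matrix.of fun p j => (1 : Matrix (Fin N) (Fin N) ℝ) p.1 j * w p.2.1 * w p.2.2

/-- The pDCA subproblem objective
`G(w) = f_cvx(w) + (τ_dc/2) wᵀw + ρ‖w‖₁ - (τ_dc wʲ - ∇f_ncvx(wʲ) + ρ sʲ)ᵀ w`. -/
def Gpdca {N T : ℕ} (l1 l2 l3 l4 α ρ : ℝ) (μ : Fin N → ℝ) (r : Fin T → Fin N → ℝ)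
    (wj sj w : Fin N → ℝ) : ℝ :=
  fcvx l1 l2 μ r w + tauDC α l3 l4 r / 2 * (w ⬝ᵥ w) + ρ * ell1 w
    - (tauDC α l3 l4 r • wj - gradfncvx l3 l4 r wj + ρ • sj) ⬝ᵥ w

end

/-- The linear functional `w ↦ wᵀ a`. -/
noncomputable def dotCLM {N : ℕ} (a : Fin N → ℝ) : (Fin N → ℝ) →L[ℝ] ℝ :=
  LinearMap.toContinuousLinearMap ((dotProductBilin ℝ ℝ).flip a)

theorem dotCLM_apply {N : ℕ} (a w : Fin N → ℝ) : dotCLM a w = w ⬝ᵥ a := rfl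

theorem hasFDerivAt_phi3 {N T : ℕ} (r : Fin T → Fin N → ℝ) (w : Fin N → ℝ) :
    HasFDerivAt (phi3 r)
      ((1 / (T : ℝ)) • ∑ t, (3 * dotCLM (r t) w ^ 2) • dotCLM (r t)) w := by
  have h : HasFDerivAt (fun x => ∑ t, dotCLM (r t) x ^ 3)
      (∑ t, (3 * dotCLM (r t) w ^ 2) • dotCLM (r t)) w :=
    HasFDerivAt.fun_sum fun t _ => by
      simpa using (dotCLM (r t)).hasFDerivAt.pow (x := w) 3
  exact h.const_mul _

theorem fderiv_phi3 {N T : ℕ} (r : Fin T → Fin N → ℝ) :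
    (fun x => fderiv ℝ (phi3 r) x) =
      fun x => (1 / (T : ℝ)) • ∑ t, (3 * dotCLM (r t) x ^ 2) • dotCLM (r t) :=
  funext fun x => (hasFDerivAt_phi3 r x).fderiv

theorem hasFDerivAt_fderiv_phi3 {N T : ℕ} (r : Fin T → Fin N → ℝ) (w : Fin N → ℝ) :
    HasFDerivAt (fun x => fderiv ℝ (phi3 r) x)
      ((1 / (T : ℝ)) • ∑ t, ((6 * dotCLM (r t) w) • dotCLM (r t)).smulRight (dotCLM (r t))) w := by
  rw [fderiv_phi3]
  have h (t : Fin T) : HasFDerivAt (fun x => 3 * dotCLM (r t) x ^ 2)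
      ((6 * dotCLM (r t) w) • dotCLM (r t)) w := by
    refine (((dotCLM (r t)).hasFDerivAt.pow (x := w) 2).const_mul 3).congr_fderiv ?_
    refine ContinuousLinearMap.ext fun v => ?_
    simp
    ring
  have hsum : HasFDerivAt (fun x => ∑ t, (3 * dotCLM (r t) x ^ 2) • dotCLM (r t))
      (∑ t, ((6 * dotCLM (r t) w) • dotCLM (r t)).smulRight (dotCLM (r t))) w :=
    HasFDerivAt.fun_sum fun t _ => (h t).smul_const (dotCLM (r t))
  exact hsum.const_smul (1 / (T : ℝ))

theorem coskew_mul_kronIdVec {N T : ℕ} (r : Fin T → Fin N → ℝ) (w : Fin N → ℝ) :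
    coskew r * kronIdVec w =
      (1 / (T : ℝ)) • ∑ t, (w ⬝ᵥ r t) • vecMulVec (r t) (r t) := by
  rw [coskew, Matrix.smul_mul, Matrix.sum_mul]
  congr 1
  refine Finset.sum_congr rfl fun t _ => ?_
  ext i j
  simp only [Matrix.mul_apply, Matrix.smul_apply, smul_eq_mul, Matrix.of_apply, vecMulVec_apply,
    kron2, kronIdVec, Fintype.sum_prod_type, Matrix.one_apply, dotProduct, Finset.sum_mul]
  rw [Finset.sum_comm]
  refine Finset.sum_congr rfl fun k _ => ?_
  simp only [ite_mul, one_mul, zero_mul, mul_ite, mul_zero, Finset.sum_ite_eq',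
    Finset.mem_univ, if_true]
  ring

/-- `φ₃` is twice differentiable with Hessian `∇²φ₃(w) = 6 Φ (I_N ⊗ w)`:
the second Fréchet derivative at `w` applied to `(u, v)` equals `uᵀ (6 Φ (I_N ⊗ w)) v`. -/
theorem phi3_hessian {N T : ℕ} (hT : 1 ≤ T) (r : Fin T → Fin N → ℝ) :
    Differentiable ℝ (phi3 r) ∧
      Differentiable ℝ (fun x => fderiv ℝ (phi3 r) x) ∧
      ∀ (w u v : Fin N → ℝ),
        fderiv ℝ (fun x => fderiv ℝ (phi3 r) x) w u v =
          u ⬝ᵥ ((6 : ℝ) • (coskew r * kronIdVec w)).mulVec v := by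
  refine ⟨fun w => (hasFDerivAt_phi3 r w).differentiableAt,
    fun w => (hasFDerivAt_fderiv_phi3 r w).differentiableAt, fun w u v => ?_⟩
  rw [(hasFDerivAt_fderiv_phi3 r w).fderiv, coskew_mul_kronIdVec]
  simp only [Matrix.smul_mulVec, Matrix.sum_mulVec, dotProduct_smul, dotProduct_sum,
    vecMulVec_mulVec, _root_.smul_apply, _root_.sum_apply,
    ContinuousLinearMap.smulRight_apply, dotCLM_apply, smul_eq_mul, Finset.mul_sum]
  refine Finset.sum_congr rfl fun t _ => ?_
  simp [dotProduct_comm (r t) v]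
  ring
end

section
/- Let τ_dc = 6 α λ₃ · max_{1≤i≤N} Σ_{j=1}^{N²} |Φ_{ij}| + 12 α² λ₄ · max_{1≤i≤N} Σ_{j=1}^{N³} |Ψ_{ij}|. Then the function w ↦ (τ_dc/2) wᵀw − f_ncvx(w) is convex on the box B = {w ∈ ℝ^N : |w_i| ≤ α for all i}; consequently f_ncvx is, on B, a difference of two convex functions: f_ncvx(w) = (τ_dc/2) wᵀw − ((τ_dc/2) wᵀw − f_ncvx(w)). -/
open Matrix Finset Filter Topology

lemma row_sum_le_maxRowSum {N : ℕ} {J : Type} [Fintype J] (A : Matrix (Fin N) J ℝ) (i : Fin N) :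
    ∑ j, |A i j| ≤ maxRowSum A :=
  le_csSup (Set.finite_range _).bddAbove ⟨i, rfl⟩

/-- A Schur-test bound for a matrix that is symmetric in its row index and the first component of
its column index. -/
lemma abs_dotProduct_mulVec_le {N : ℕ} {K : Type} [Fintype K]
    (A : Matrix (Fin N) (Fin N × K) ℝ) (hA : ∀ i j k, A i (j, k) = A j (i, k))
    (h : Fin N → ℝ) (b : K → ℝ) {β : ℝ} (hβ : 0 ≤ β) (hb : ∀ k, |b k| ≤ β) :
    |h ⬝ᵥ A.mulVec (fun p => h p.1 * b p.2)| ≤ β * maxRowSum A * (h ⬝ᵥ h) := by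
  have expand : h ⬝ᵥ A.mulVec (fun p => h p.1 * b p.2) =
      ∑ i, ∑ j, ∑ k, A i (j, k) * (h i * h j * b k) := by
    simp only [dotProduct, mulVec, Fintype.sum_prod_type, Finset.mul_sum]
    exact sum_congr rfl fun i _ => sum_congr rfl fun j _ => sum_congr rfl fun k _ => by ring
  have term (i j : Fin N) (k : K) : |A i (j, k) * (h i * h j * b k)| ≤
      β / 2 * (|A i (j, k)| * h i ^ 2) + β / 2 * (|A j (i, k)| * h j ^ 2) := by
    rw [hA j i k, abs_mul, abs_mul, abs_mul]
    have h1 : |h i| * |h j| ≤ (h i ^ 2 + h j ^ 2) / 2 := by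
      nlinarith [sq_nonneg (|h i| - |h j|), sq_abs (h i), sq_abs (h j)]
    calc |A i (j, k)| * (|h i| * |h j| * |b k|)
        ≤ |A i (j, k)| * ((h i ^ 2 + h j ^ 2) / 2 * β) := by
          gcongr
          exact hb k
      _ = _ := by ring
  have rows : ∑ i, ∑ j, ∑ k, |A i (j, k)| * h i ^ 2 ≤ maxRowSum A * (h ⬝ᵥ h) := by
    simp only [dotProduct, Finset.mul_sum]
    refine sum_le_sum fun i _ => ?_
    have := row_sum_le_maxRowSum A i
    rw [Fintype.sum_prod_type] at this
    simp only [← Finset.sum_mul]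
    rw [← sq]
    gcongr
  rw [expand]
  calc |∑ i, ∑ j, ∑ k, A i (j, k) * (h i * h j * b k)|
      ≤ ∑ i, ∑ j, ∑ k, |A i (j, k) * (h i * h j * b k)| :=
        (abs_sum_le_sum_abs _ _).trans <| sum_le_sum fun i _ =>
          (abs_sum_le_sum_abs _ _).trans <| sum_le_sum fun j _ => abs_sum_le_sum_abs _ _
    _ ≤ ∑ i, ∑ j, ∑ k,
        (β / 2 * (|A i (j, k)| * h i ^ 2) + β / 2 * (|A j (i, k)| * h j ^ 2)) :=
        sum_le_sum fun i _ => sum_le_sum fun j _ => sum_le_sum fun k _ => term i j k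
    _ = β * ∑ i, ∑ j, ∑ k, |A i (j, k)| * h i ^ 2 := by
        simp only [sum_add_distrib, ← Finset.mul_sum]
        rw [sum_comm (f := fun i j => ∑ k, |A j (i, k)| * h j ^ 2)]
        ring
    _ ≤ β * (maxRowSum A * (h ⬝ᵥ h)) := by gcongr
    _ = _ := by ring

lemma dotProduct_prod {I K : Type*} [Fintype I] [Fintype K] (a c : I → ℝ) (b d : K → ℝ) :
    (fun p : I × K => a p.1 * b p.2) ⬝ᵥ (fun p => c p.1 * d p.2) = (a ⬝ᵥ c) * (b ⬝ᵥ d) := by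
  simp only [dotProduct, Fintype.sum_prod_type, Finset.sum_mul_sum]
  exact sum_congr rfl fun i _ => sum_congr rfl fun k _ => by ring

lemma dotProduct_sum_vecMulVec_mulVec {I J ι : Type*} [Fintype I] [Fintype J] [Fintype ι]
    (c : ℝ) (u : ι → I → ℝ) (k : ι → J → ℝ) (x : I → ℝ) (v : J → ℝ) :
    x ⬝ᵥ (c • ∑ t, vecMulVec (u t) (k t)).mulVec v = c * ∑ t, (x ⬝ᵥ u t) * (k t ⬝ᵥ v) := by
  simp only [smul_mulVec, sum_mulVec, dotProduct_smul, dotProduct_sum, vecMulVec_mulVec,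
    smul_eq_mul, op_smul_eq_smul, mul_comm (_ ⬝ᵥ u _)]

lemma kron3_eq {N : ℕ} (w : Fin N → ℝ) : kron3 w = fun p => w p.1 * kron2 w p.2 := by
  funext p
  simp only [kron3, kron2]
  ring

lemma dotProduct_coskew_mulVec {N T : ℕ} (r : Fin T → Fin N → ℝ) (x y z : Fin N → ℝ) :
    x ⬝ᵥ (coskew r).mulVec (fun p => y p.1 * z p.2) =
      (1 / (T : ℝ)) * ∑ t, (x ⬝ᵥ r t) * ((y ⬝ᵥ r t) * (z ⬝ᵥ r t)) := by
  unfold coskew kron2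
  simp only [dotProduct_sum_vecMulVec_mulVec, dotProduct_prod, dotProduct_comm (r _)]

lemma dotProduct_cokurt_mulVec {N T : ℕ} (r : Fin T → Fin N → ℝ) (x y z v : Fin N → ℝ) :
    x ⬝ᵥ (cokurt r).mulVec (fun p => y p.1 * (fun q : Fin N × Fin N => z q.1 * v q.2) p.2) =
      (1 / (T : ℝ)) * ∑ t, (x ⬝ᵥ r t) * ((y ⬝ᵥ r t) * ((z ⬝ᵥ r t) * (v ⬝ᵥ r t))) := by
  simp only [cokurt, dotProduct_sum_vecMulVec_mulVec]
  congr 1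
  refine sum_congr rfl fun t _ => ?_
  rw [kron3_eq, dotProduct_prod (r t) y (kron2 (r t)) fun q => z q.1 * v q.2]
  unfold kron2
  rw [dotProduct_prod]
  simp only [dotProduct_comm (r t)]

lemma fncvx_eq_phi {N T : ℕ} (l3 l4 : ℝ) (r : Fin T → Fin N → ℝ) (w : Fin N → ℝ) :
    fncvx l3 l4 r w = -l3 * phi3 r w + l4 * phi4 r w := by
  have h3 : w ⬝ᵥ (coskew r).mulVec (kron2 w) = phi3 r w := by
    unfold kron2 phi3
    rw [dotProduct_coskew_mulVec]
    congr 1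
    exact sum_congr rfl fun t _ => by ring
  have h4 : w ⬝ᵥ (cokurt r).mulVec (kron3 w) = phi4 r w := by
    rw [kron3_eq]
    unfold kron2 phi4
    rw [dotProduct_cokurt_mulVec]
    congr 1
    exact sum_congr rfl fun t _ => by ring
  rw [fncvx, h3, h4]

lemma coskew_swap {N T : ℕ} (r : Fin T → Fin N → ℝ) (i j k : Fin N) :
    coskew r i (j, k) = coskew r j (i, k) := by
  simp only [coskew, Matrix.smul_apply, Matrix.sum_apply, vecMulVec_apply, kron2]
  congr 1
  exact sum_congr rfl fun t _ => by ring

lemma cokurt_swap {N T : ℕ} (r : Fin T → Fin N → ℝ) (i j : Fin N) (k : Fin N × Fin N) :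
    cokurt r i (j, k) = cokurt r j (i, k) := by
  simp only [cokurt, Matrix.smul_apply, Matrix.sum_apply, vecMulVec_apply, kron3]
  congr 1
  exact sum_congr rfl fun t _ => by ring

lemma convex_box {N : ℕ} (α : ℝ) : Convex ℝ {w : Fin N → ℝ | ∀ i, |w i| ≤ α} := by
  have : {w : Fin N → ℝ | ∀ i, |w i| ≤ α} = Set.Icc (fun _ => -α) (fun _ => α) := by
    ext w
    simp only [Set.mem_ofPred_eq, abs_le, Set.mem_Icc, Pi.le_def, forall_and]
  rw [this]
  exact convex_Icc _ _

lemma dotProduct_self_convexComb {N : ℕ} (x y : Fin N → ℝ) {a b : ℝ} (hab : a + b = 1) :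
    a * (x ⬝ᵥ x) + b * (y ⬝ᵥ y) - (a • x + b • y) ⬝ᵥ (a • x + b • y) =
      a * b * ((x - y) ⬝ᵥ (x - y)) := by
  obtain rfl : b = 1 - a := by linarith
  simp only [add_dotProduct, dotProduct_add, smul_dotProduct, dotProduct_smul, sub_dotProduct,
    dotProduct_sub, smul_eq_mul, dotProduct_comm y x]
  ring

lemma convexOn_add_phi3 {N T : ℕ} {α : ℝ} (hα : 0 ≤ α) (r : Fin T → Fin N → ℝ) :
    ConvexOn ℝ {w : Fin N → ℝ | ∀ i, |w i| ≤ α}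
      (fun w => 3 * α * maxRowSum (coskew r) * (w ⬝ᵥ w) + phi3 r w) := by
  refine ⟨convex_box α, fun x hx y hy a b ha hb hab => ?_⟩
  have bound := (abs_le.1 <| abs_dotProduct_mulVec_le (coskew r) (coskew_swap r) (x - y)
    ((1 + a) • x + (1 + b) • y) (β := 3 * α) (by positivity) fun i => by
      calc |((1 + a) • x + (1 + b) • y) i|
          ≤ |(1 + a) * x i| + |(1 + b) * y i| := abs_add_le _ _
        _ = (1 + a) * |x i| + (1 + b) * |y i| := by
          rw [abs_mul, abs_mul, abs_of_nonneg (by linarith : 0 ≤ 1 + a),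
            abs_of_nonneg (by linarith : 0 ≤ 1 + b)]
        _ ≤ (1 + a) * α + (1 + b) * α := by
          gcongr
          exacts [hx i, hy i]
        _ = 3 * α := by linear_combination α * hab).1
  have gap : a * phi3 r x + b * phi3 r y - phi3 r (a • x + b • y) =
      a * b * ((x - y) ⬝ᵥ (coskew r).mulVec
        (fun p => (x - y) p.1 * ((1 + a) • x + (1 + b) • y) p.2)) := by
    obtain rfl : b = 1 - a := by linarith
    rw [dotProduct_coskew_mulVec]
    simp only [phi3, Finset.mul_sum, ← sum_add_distrib, ← sum_sub_distrib]
    refine sum_congr rfl fun t _ => ?_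
    simp only [add_dotProduct, smul_dotProduct, sub_dotProduct, smul_eq_mul]
    ring
  have quad := dotProduct_self_convexComb x y hab
  have := mul_le_mul_of_nonneg_left bound (mul_nonneg ha hb)
  simp only [smul_eq_mul]
  linear_combination this - gap - 3 * α * maxRowSum (coskew r) * quad

lemma convexOn_sub_phi4 {N T : ℕ} {α : ℝ} (hα : 0 ≤ α) (r : Fin T → Fin N → ℝ) :
    ConvexOn ℝ {w : Fin N → ℝ | ∀ i, |w i| ≤ α}
      (fun w => 6 * α ^ 2 * maxRowSum (cokurt r) * (w ⬝ᵥ w) - phi4 r w) := by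
  refine ⟨convex_box α, fun x hx y hy a b ha hb hab => ?_⟩
  have bound (z v : Fin N → ℝ) (hz : ∀ i, |z i| ≤ α) (hv : ∀ i, |v i| ≤ α) :=
    (abs_le.1 <| abs_dotProduct_mulVec_le (cokurt r) (cokurt_swap r) (x - y)
      (fun q => z q.1 * v q.2) (β := α ^ 2) (by positivity) fun q => by
        rw [abs_mul, sq]
        exact mul_le_mul (hz _) (hv _) (abs_nonneg _) hα).2
  have gap : a * phi4 r x + b * phi4 r y - phi4 r (a • x + b • y) =
      a * b * ((1 + a + a ^ 2) * ((x - y) ⬝ᵥ (cokurt r).mulVec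
          (fun p => (x - y) p.1 * (fun q : Fin N × Fin N => x q.1 * x q.2) p.2))
        + (2 + 2 * (a * b)) * ((x - y) ⬝ᵥ (cokurt r).mulVec
          (fun p => (x - y) p.1 * (fun q : Fin N × Fin N => x q.1 * y q.2) p.2))
        + (1 + b + b ^ 2) * ((x - y) ⬝ᵥ (cokurt r).mulVec
          (fun p => (x - y) p.1 * (fun q : Fin N × Fin N => y q.1 * y q.2) p.2))) := by
    obtain rfl : b = 1 - a := by linarith
    simp only [dotProduct_cokurt_mulVec]
    simp only [phi4, Finset.mul_sum, ← sum_add_distrib, ← sum_sub_distrib]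
    refine sum_congr rfl fun t _ => ?_
    simp only [add_dotProduct, smul_dotProduct, sub_dotProduct, smul_eq_mul]
    ring
  have quad := dotProduct_self_convexComb x y hab
  have key : a * phi4 r x + b * phi4 r y - phi4 r (a • x + b • y) ≤
      a * b * (6 * (α ^ 2 * maxRowSum (cokurt r) * ((x - y) ⬝ᵥ (x - y)))) := by
    rw [gap]
    refine mul_le_mul_of_nonneg_left ?_ (mul_nonneg ha hb)
    have h1 := mul_le_mul_of_nonneg_left (bound x x hx hx) (by positivity : 0 ≤ 1 + a + a ^ 2)
    have h2 := mul_le_mul_of_nonneg_left (bound x y hx hy) (by positivity : 0 ≤ 2 + 2 * (a * b))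
    have h3 := mul_le_mul_of_nonneg_left (bound y y hy hy) (by positivity : 0 ≤ 1 + b + b ^ 2)
    refine (add_le_add (add_le_add h1 h2) h3).trans_eq ?_
    obtain rfl : b = 1 - a := by linarith
    ring
  simp only [smul_eq_mul]
  linear_combination key - 6 * α ^ 2 * maxRowSum (cokurt r) * quad

/-- with `τ_dc = 6αλ₃ maxᵢ ∑ⱼ |Φᵢⱼ| + 12α²λ₄ maxᵢ ∑ⱼ |Ψᵢⱼ|`, the function
`w ↦ (τ_dc/2) wᵀw − f_ncvx(w)` is convex on the box `B = {w : |wᵢ| ≤ α ∀i}`; consequently,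
on `B`, `f_ncvx` is the difference of the convex functions `(τ_dc/2) wᵀw` and
`(τ_dc/2) wᵀw − f_ncvx(w)`. -/
theorem fncvx_dc_decomposition {N T : ℕ} (hN : 0 < N) (hT : 1 ≤ T)
    (l3 l4 α : ℝ) (hl3 : 0 < l3) (hl4 : 0 < l4) (hα : 0 < α)
    (r : Fin T → Fin N → ℝ) :
    ConvexOn ℝ {w : Fin N → ℝ | ∀ i, |w i| ≤ α}
        (fun w => tauDC α l3 l4 r / 2 * (w ⬝ᵥ w) - fncvx l3 l4 r w) ∧
      ∀ w : Fin N → ℝ,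
        fncvx l3 l4 r w =
          tauDC α l3 l4 r / 2 * (w ⬝ᵥ w)
            - (tauDC α l3 l4 r / 2 * (w ⬝ᵥ w) - fncvx l3 l4 r w) := by
  refine ⟨?_, fun w => by ring⟩
  refine (((convexOn_add_phi3 hα.le r).smul hl3.le).add
    ((convexOn_sub_phi4 hα.le r).smul hl4.le)).congr fun w _ => ?_
  simp only [fncvx_eq_phi, tauDC, Pi.add_apply, smul_eq_mul]
  ring
end

section
/- Fix w^j ∈ C, a subgradient s^j of the largest-k norm at w^j, ŵ ∈ C with ŵ ≠ w^j, c ∈ (0, 1), β ∈ (0, 1), and set d = ŵ − w^j and Δ_j = dᵀ(∇f(w^j) − ρ s^j) + ρ(‖ŵ‖₁ − ‖w^j‖₁). If Δ_j < 0, then the backtracking line search terminates: there exists a nonnegative integer m such that γ = β^m satisfies the Armijo condition f(w^j + γ d) − γ ρ dᵀ s^j + γ ρ (‖ŵ‖₁ − ‖w^j‖₁) ≤ f(w^j) + c γ Δ_j; in particular, a smallest such m exists. -/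
open Matrix Finset Filter Topology

theorem dotProduct_smul_sum_vecMulVec_mulVec {ι κ τ : Type*} [Fintype ι] [Fintype κ] [Fintype τ]
    (a : ℝ) (u : τ → ι → ℝ) (v : τ → κ → ℝ) (x : ι → ℝ) (y : κ → ℝ) :
    x ⬝ᵥ (a • ∑ t, vecMulVec (u t) (v t)).mulVec y = a * ∑ t, (x ⬝ᵥ u t) * (y ⬝ᵥ v t) := by
  rw [smul_mulVec, dotProduct_smul, sum_mulVec, dotProduct_sum, smul_eq_mul]
  congr 1
  refine Finset.sum_congr rfl fun t _ => ?_
  rw [vecMulVec_mulVec, dotProduct_comm y]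
  simp [dotProduct_smul, mul_comm]

theorem kron2_dotProduct_kron2 {N : ℕ} (a b : Fin N → ℝ) :
    kron2 a ⬝ᵥ kron2 b = (a ⬝ᵥ b) ^ 2 := by
  simp only [dotProduct, kron2, sq, Finset.sum_mul_sum, Fintype.sum_prod_type]
  exact Finset.sum_congr rfl fun i _ => Finset.sum_congr rfl fun j _ => by ring

theorem kron3_dotProduct_kron3 {N : ℕ} (a b : Fin N → ℝ) :
    kron3 a ⬝ᵥ kron3 b = (a ⬝ᵥ b) ^ 3 := by
  simp only [dotProduct, kron3, pow_succ, pow_zero, one_mul,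
    Fintype.sum_prod_type, Finset.sum_mul, Finset.mul_sum]
  exact Finset.sum_congr rfl fun i _ => Finset.sum_congr rfl fun j _ =>
    Finset.sum_congr rfl fun k _ => by ring

theorem dotProduct_covar_mulVec {N T : ℕ} (r : Fin T → Fin N → ℝ) (x y : Fin N → ℝ) :
    x ⬝ᵥ (covar r).mulVec y = 1 / (T : ℝ) * ∑ t, (x ⬝ᵥ r t) * (y ⬝ᵥ r t) :=
  dotProduct_smul_sum_vecMulVec_mulVec ..

theorem dotProduct_coskew_mulVec_kron2 {N T : ℕ} (r : Fin T → Fin N → ℝ) (x y : Fin N → ℝ) :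
    x ⬝ᵥ (coskew r).mulVec (kron2 y) = 1 / (T : ℝ) * ∑ t, (x ⬝ᵥ r t) * (y ⬝ᵥ r t) ^ 2 := by
  rw [coskew, dotProduct_smul_sum_vecMulVec_mulVec]
  simp only [kron2_dotProduct_kron2]

theorem dotProduct_cokurt_mulVec_kron3 {N T : ℕ} (r : Fin T → Fin N → ℝ) (x y : Fin N → ℝ) :
    x ⬝ᵥ (cokurt r).mulVec (kron3 y) = 1 / (T : ℝ) * ∑ t, (x ⬝ᵥ r t) * (y ⬝ᵥ r t) ^ 3 := by
  rw [cokurt, dotProduct_smul_sum_vecMulVec_mulVec]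
  simp only [kron3_dotProduct_kron3]

theorem hasDerivAt_sum_dotProduct_line {N T : ℕ} (r : Fin T → Fin N → ℝ) (w d : Fin N → ℝ)
    (n : ℕ) :
    HasDerivAt (fun γ : ℝ => ∑ t, ((w + γ • d) ⬝ᵥ r t) * ((w + γ • d) ⬝ᵥ r t) ^ n)
      ((n + 1) * ∑ t, (d ⬝ᵥ r t) * (w ⬝ᵥ r t) ^ n) 0 := by
  rw [Finset.mul_sum]
  refine HasDerivAt.fun_sum fun t _ => ?_
  have h : HasDerivAt (fun γ : ℝ => w ⬝ᵥ r t + γ * (d ⬝ᵥ r t)) (d ⬝ᵥ r t) 0 := by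
    simpa using ((hasDerivAt_id (0 : ℝ)).mul_const (d ⬝ᵥ r t)).const_add (w ⬝ᵥ r t)
  simp only [add_dotProduct, smul_dotProduct, smul_eq_mul, ← pow_succ']
  refine (h.fun_pow (n + 1)).congr_deriv ?_
  simp
  ring

/-- `gradf` gives the directional derivatives of `ftot`. -/
theorem hasDerivAt_ftot_line {N T : ℕ} (l1 l2 l3 l4 : ℝ) (μ : Fin N → ℝ)
    (r : Fin T → Fin N → ℝ) (w d : Fin N → ℝ) :
    HasDerivAt (fun γ : ℝ => ftot l1 l2 l3 l4 μ r (w + γ • d))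
      (d ⬝ᵥ gradf l1 l2 l3 l4 μ r w) 0 := by
  have h1 : HasDerivAt (fun γ : ℝ => μ ⬝ᵥ (w + γ • d)) (μ ⬝ᵥ d) 0 := by
    simpa [dotProduct_add, dotProduct_smul] using
      ((hasDerivAt_id (0 : ℝ)).mul_const (μ ⬝ᵥ d)).const_add (μ ⬝ᵥ w)
  have hm := fun n => (hasDerivAt_sum_dotProduct_line r w d n).const_mul (1 / (T : ℝ))
  have h2 := hm 1
  simp only [pow_one] at h2
  simp only [ftot, fcvx, fncvx, gradf, gradfncvx, dotProduct_covar_mulVec,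
    dotProduct_coskew_mulVec_kron2, dotProduct_cokurt_mulVec_kron3, dotProduct_add,
    dotProduct_smul, smul_eq_mul]
  simp only [dotProduct_add, dotProduct_smul, smul_eq_mul] at h1
  refine (((h1.const_mul (-l1)).fun_add (h2.const_mul l2)).fun_add
    (((hm 2).const_mul (-l3)).fun_add ((hm 3).const_mul l4))).congr_deriv ?_
  rw [dotProduct_comm μ d]
  push_cast
  ring

/-- If `L < K`, then `g` lies below the line of slope `K` through `(0, g 0)` at some `β ^ m`. -/
theorem exists_pow_le_of_hasDerivAt_lt {g : ℝ → ℝ} {L K β : ℝ} (hg : HasDerivAt g L 0)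
    (hLK : L < K) (hβ0 : 0 < β) (hβ1 : β < 1) : ∃ m : ℕ, g (β ^ m) ≤ g 0 + β ^ m * K := by
  have hpow : Tendsto (fun m : ℕ => β ^ m) atTop (𝓝[>] 0) :=
    tendsto_nhdsWithin_iff.2 ⟨tendsto_pow_atTop_nhds_zero_of_lt_one hβ0.le hβ1,
      .of_forall fun m => pow_pos hβ0 m⟩
  obtain ⟨m, hm⟩ := ((hg.tendsto_slope_zero_right.comp hpow).eventually_lt_const hLK).exists
  have hpos := pow_pos hβ0 m
  simp only [Function.comp_apply, zero_add, smul_eq_mul] at hm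
  rw [inv_mul_lt_iff₀ hpos] at hm
  exact ⟨m, by linarith⟩

/-- termination of the backtracking line search. If `ŵ ≠ wʲ` and
`Δⱼ = dᵀ(∇f(wʲ) − ρ sʲ) + ρ(‖ŵ‖₁ − ‖wʲ‖₁) < 0`, then some nonnegative integer `m` gives a
stepsize `γ = βᵐ` satisfying the Armijo condition; in particular a smallest such `m`
exists. -/
theorem backtracking_terminates {N T : ℕ} (hN : 0 < N) (hT : 1 ≤ T)
    (l1 l2 l3 l4 α ρ c β : ℝ) (hl1 : 0 < l1) (hl2 : 0 < l2) (hl3 : 0 < l3) (hl4 : 0 < l4)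
    (hα : 0 < α) (hρ : 0 < ρ) (hc : 0 < c ∧ c < 1) (hβ : 0 < β ∧ β < 1)
    (k : ℕ) (hk1 : 1 ≤ k) (hkN : k ≤ N)
    (μ : Fin N → ℝ) (r : Fin T → Fin N → ℝ)
    (wj sj what : Fin N → ℝ)
    (hwj : wj ∈ Feas N α)
    (hsj : IsSubgradTopk k wj sj)
    (hwhat : what ∈ Feas N α)
    (hne : what ≠ wj)
    (d : Fin N → ℝ) (hd : d = what - wj)
    (Δ : ℝ)
    (hΔ : Δ = d ⬝ᵥ (gradf l1 l2 l3 l4 μ r wj - ρ • sj) + ρ * (ell1 what - ell1 wj))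
    (hΔneg : Δ < 0) :
    ∃ m : ℕ,
      (ftot l1 l2 l3 l4 μ r (wj + β ^ m • d) - β ^ m * ρ * (d ⬝ᵥ sj)
          + β ^ m * ρ * (ell1 what - ell1 wj) ≤ ftot l1 l2 l3 l4 μ r wj + c * β ^ m * Δ) ∧
      ∀ m' : ℕ,
        (ftot l1 l2 l3 l4 μ r (wj + β ^ m' • d) - β ^ m' * ρ * (d ⬝ᵥ sj)
            + β ^ m' * ρ * (ell1 what - ell1 wj)
          ≤ ftot l1 l2 l3 l4 μ r wj + c * β ^ m' * Δ) → m ≤ m' := by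
  classical
  have hex : ∃ m : ℕ, ftot l1 l2 l3 l4 μ r (wj + β ^ m • d) - β ^ m * ρ * (d ⬝ᵥ sj)
      + β ^ m * ρ * (ell1 what - ell1 wj) ≤ ftot l1 l2 l3 l4 μ r wj + c * β ^ m * Δ := by
    have hlt : d ⬝ᵥ gradf l1 l2 l3 l4 μ r wj
        < c * Δ + ρ * (d ⬝ᵥ sj) - ρ * (ell1 what - ell1 wj) := by
      rw [dotProduct_sub, dotProduct_smul, smul_eq_mul] at hΔ
      nlinarith [mul_pos (sub_pos.2 hc.2) (neg_pos.2 hΔneg)]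
    obtain ⟨m, hm⟩ := exists_pow_le_of_hasDerivAt_lt
      (hasDerivAt_ftot_line l1 l2 l3 l4 μ r wj d) hlt hβ.1 hβ.2
    rw [zero_smul, add_zero] at hm
    exact ⟨m, by linarith⟩
  exact ⟨Nat.find hex, Nat.find_spec hex, fun m' hm' => Nat.find_min' hex hm'⟩
end
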